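/- Let X be a finite unique path space and let ℤ[X] be its integral incidence algebra. The sequence of ℤ[X]-bimodules 0 → ⊕_{y→x} ℤ[X]e_x ⊗_ℤ e_yℤ[X] → ⊕_{x∈X} ℤ[X]e_x ⊗_ℤ e_xℤ[X] → ℤ[X] → 0 is exact, where the sum in the first term is over all covering relations y → x, the second map is determined on each summand by a ⊗ b ↦ a·b, and the first map is determined on the summand indexed by y → x by a ⊗ b ↦ (a ⊗ f_{x⪯y}·b, −a·f_{x⪯y} ⊗ b), landing in the summands indexed by x and by y respectively. -/

import Mathlib

/-!
STATEMENT 12: Let X be a finite unique path space and let ℤ[X] be its integral incidence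
algebra. The sequence of ℤ[X]-bimodules
0 → ⊕_{y→x} ℤ[X]e_x ⊗_ℤ e_yℤ[X] → ⊕_{x∈X} ℤ[X]e_x ⊗_ℤ e_xℤ[X] → ℤ[X] → 0
is exact, where the sum in the first term is over all covering relations y → x, the second
map is determined on each summand by a ⊗ b ↦ a·b, and the first map is determined on the
summand indexed by y → x by a ⊗ b ↦ (a ⊗ f_{x⪯y}·b, −a·f_{x⪯y} ⊗ b).
-/

noncomputable section
set_option linter.unusedSectionVars false

open TensorProduct

section Defs

variable {X : Type} [PartialOrder X] [LocallyFiniteOrder X] [DecidableEq X]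

/-- The basis element `f_{x⪯y}` of the integral incidence algebra `ℤ[X]`. -/
def ups (x y : X) (h : x ≤ y) : IncidenceAlgebra ℤ X :=
  ⟨fun a b => if a = x ∧ b = y then 1 else 0, fun a b hab =>
    if_neg (by rintro ⟨rfl, rfl⟩; exact hab h)⟩

lemma ups_mul_ups (x y z : X) (h1 : x ≤ y) (h2 : y ≤ z) :
    ups x y h1 * ups y z h2 = ups x z (h1.trans h2) := by
  ext a b hab
  rw [IncidenceAlgebra.mul_apply]
  show (∑ c ∈ Finset.Icc a b,
    (if a = x ∧ c = y then (1 : ℤ) else 0) * (if c = y ∧ b = z then 1 else 0)) =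
    if a = x ∧ b = z then 1 else 0
  rcases eq_or_ne a x with rfl | ha
  · rcases eq_or_ne b z with rfl | hb
    · rw [Finset.sum_eq_single y]
      · simp
      · intro c _ hcy
        simp [hcy]
      · intro hy
        exact absurd (Finset.mem_Icc.2 ⟨h1, h2⟩) hy
    · simp only [hb, and_false, if_false]
      apply Finset.sum_eq_zero
      intro c _
      rcases eq_or_ne c y with rfl | hcy
      · simp [hb]
      · simp [hcy]
  · simp only [ha, false_and, if_false]
    apply Finset.sum_eq_zero
    intro c _
    simp [ha]

/-- The idempotent `e_x = f_{x⪯x}` of `ℤ[X]`. -/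
def eIdem (x : X) : IncidenceAlgebra ℤ X := ups x x le_rfl

/-- The left ideal `ℤ[X]·e_x`, as a `ℤ`-submodule of `ℤ[X]`. -/
def Lmod (x : X) : Submodule ℤ (IncidenceAlgebra ℤ X) :=
  LinearMap.range (AddMonoidHom.mulRight (eIdem x)).toIntLinearMap

/-- The right ideal `e_x·ℤ[X]`, as a `ℤ`-submodule of `ℤ[X]`. -/
def Rmod (x : X) : Submodule ℤ (IncidenceAlgebra ℤ X) :=
  LinearMap.range (AddMonoidHom.mulLeft (eIdem x)).toIntLinearMap

lemma mul_ups_mem_Lmod (a : IncidenceAlgebra ℤ X) {x y : X} (h : x ≤ y) :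
    a * ups x y h ∈ Lmod y := by
  refine ⟨a * ups x y h, ?_⟩
  show (a * ups x y h) * eIdem y = a * ups x y h
  rw [eIdem, mul_assoc, ups_mul_ups]

lemma ups_mul_mem_Rmod (b : IncidenceAlgebra ℤ X) {x y : X} (h : x ≤ y) :
    ups x y h * b ∈ Rmod x := by
  refine ⟨ups x y h * b, ?_⟩
  show eIdem x * (ups x y h * b) = ups x y h * b
  rw [eIdem, ← mul_assoc, ups_mul_ups]

lemma Lmod_mem_of_mul_left (c : IncidenceAlgebra ℤ X) {x : X}
    {a : IncidenceAlgebra ℤ X} (ha : a ∈ Lmod x) : c * a ∈ Lmod x := by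
  obtain ⟨w, rfl⟩ := ha
  exact ⟨c * w, mul_assoc c w (eIdem x)⟩

lemma Rmod_mem_of_mul_right (c : IncidenceAlgebra ℤ X) {x : X}
    {b : IncidenceAlgebra ℤ X} (hb : b ∈ Rmod x) : b * c ∈ Rmod x := by
  obtain ⟨w, rfl⟩ := hb
  exact ⟨w * c, (mul_assoc (eIdem x) w c).symm⟩

/-- Left multiplication by `c` on `ℤ[X]·e_x` (part of the left `ℤ[X]`-module structure). -/
def lactL (c : IncidenceAlgebra ℤ X) (x : X) : Lmod x →ₗ[ℤ] Lmod x :=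
  LinearMap.restrict (AddMonoidHom.mulLeft c).toIntLinearMap
    (fun _ ha => Lmod_mem_of_mul_left c ha)

/-- Right multiplication by `c` on `e_x·ℤ[X]` (part of the right `ℤ[X]`-module structure). -/
def ractR (c : IncidenceAlgebra ℤ X) (x : X) : Rmod x →ₗ[ℤ] Rmod x :=
  LinearMap.restrict (AddMonoidHom.mulRight c).toIntLinearMap
    (fun _ hb => Rmod_mem_of_mul_right c hb)

/-- The type of covering relations `y → x` of `X`, encoded as pairs `(x, y)` with `x ⋖ y`. -/
abbrev Cov (X : Type) [PartialOrder X] : Type := {p : X × X // p.1 ⋖ p.2}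

/-- Left `ℤ[X]`-action of `c` on `⊕_{x∈X} ℤ[X]e_x ⊗ e_xℤ[X]`. -/
def bimodLPi (c : IncidenceAlgebra ℤ X) :
    (∀ x : X, Lmod x ⊗[ℤ] Rmod x) →ₗ[ℤ] (∀ x : X, Lmod x ⊗[ℤ] Rmod x) :=
  LinearMap.pi fun x =>
    (TensorProduct.map (lactL c x) LinearMap.id).comp (LinearMap.proj x)

/-- Right `ℤ[X]`-action of `c` on `⊕_{x∈X} ℤ[X]e_x ⊗ e_xℤ[X]`. -/
def bimodRPi (c : IncidenceAlgebra ℤ X) :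
    (∀ x : X, Lmod x ⊗[ℤ] Rmod x) →ₗ[ℤ] (∀ x : X, Lmod x ⊗[ℤ] Rmod x) :=
  LinearMap.pi fun x =>
    (TensorProduct.map LinearMap.id (ractR c x)).comp (LinearMap.proj x)

/-- Left `ℤ[X]`-action of `c` on `⊕_{y→x} ℤ[X]e_x ⊗ e_yℤ[X]`. -/
def bimodLCov (c : IncidenceAlgebra ℤ X) :
    (∀ p : Cov X, Lmod p.1.1 ⊗[ℤ] Rmod p.1.2) →ₗ[ℤ]
      (∀ p : Cov X, Lmod p.1.1 ⊗[ℤ] Rmod p.1.2) :=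
  LinearMap.pi fun p =>
    (TensorProduct.map (lactL c p.1.1) LinearMap.id).comp (LinearMap.proj p)

/-- Right `ℤ[X]`-action of `c` on `⊕_{y→x} ℤ[X]e_x ⊗ e_yℤ[X]`. -/
def bimodRCov (c : IncidenceAlgebra ℤ X) :
    (∀ p : Cov X, Lmod p.1.1 ⊗[ℤ] Rmod p.1.2) →ₗ[ℤ]
      (∀ p : Cov X, Lmod p.1.1 ⊗[ℤ] Rmod p.1.2) :=
  LinearMap.pi fun p =>
    (TensorProduct.map LinearMap.id (ractR c p.1.2)).comp (LinearMap.proj p)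

end Defs

/-- A finite poset is a unique path space if any two comparable points are connected by a
unique chain of covering relations. -/
def IsUniquePathSpace (X : Type) [PartialOrder X] : Prop :=
  ∀ a b : X, a ≤ b → ∃! l : List X,
    List.Chain (fun u v : X => v ⋖ u) b l ∧
      (b :: l).getLast (List.cons_ne_nil _ _) = a

section Resolution

variable {X : Type} [PartialOrder X] [LocallyFiniteOrder X] [DecidableEq X]

lemma ups_apply (x y : X) (h : x ≤ y) (a b : X) :
    ups x y h a b = if a = x ∧ b = y then 1 else 0 := rfl

lemma mul_eIdem_apply (w : IncidenceAlgebra ℤ X) (x p q : X) :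
    (w * eIdem x) p q = if q = x then w p q else 0 := by
  by_cases hpq : p ≤ q
  · rw [IncidenceAlgebra.mul_apply, Finset.sum_eq_single q]
    · by_cases hq : q = x <;> simp [eIdem, ups_apply, hq]
    · intro c _ hc
      simp only [eIdem, ups_apply]
      rw [if_neg (fun h => hc (h.1.trans h.2.symm)), mul_zero]
    · intro h
      exact absurd (Finset.mem_Icc.2 ⟨hpq, le_rfl⟩) h
  · simp [IncidenceAlgebra.apply_eq_zero_of_not_le hpq]

lemma Lmod_apply {x : X} {a : IncidenceAlgebra ℤ X} (ha : a ∈ Lmod x) (p q : X) :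
    a p q = if q = x then a p x else 0 := by
  obtain ⟨w, rfl⟩ := ha
  change (w * eIdem x) p q = if q = x then (w * eIdem x) p x else 0
  rw [mul_eIdem_apply, mul_eIdem_apply]
  by_cases hq : q = x <;> simp [hq]

lemma eIdem_mul_Rmod {x : X} {b : IncidenceAlgebra ℤ X} (hb : b ∈ Rmod x) :
    eIdem x * b = b := by
  obtain ⟨w, rfl⟩ := hb
  change eIdem x * (eIdem x * w) = eIdem x * w
  rw [← mul_assoc, eIdem, ups_mul_ups]

lemma eIdem_mul_ups_of_ne {c a x : X} (h : a ≤ x) (hc : c ≠ a) :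
    eIdem c * ups a x h = 0 := by
  ext p q _
  rw [IncidenceAlgebra.mul_apply]
  apply Finset.sum_eq_zero
  intro r _
  simp only [eIdem, ups_apply]
  by_cases hr : r = c
  · rw [if_neg (fun h => hc (hr.symm.trans h.1)) (c := r = a ∧ q = x), mul_zero]
  · rw [if_neg (fun h => hr h.2), zero_mul]

lemma sum_eIdem [Fintype X] : ∑ x : X, eIdem x = 1 := by
  have hsum (s : Finset X) (p q : X) : (∑ x ∈ s, eIdem x) p q = ∑ x ∈ s, eIdem x p q := by
    induction s using Finset.induction_on with
    | empty => simp
    | insert a s ha ih => rw [Finset.sum_insert ha, Finset.sum_insert ha, ← ih]; rfl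
  ext p q _
  rw [hsum, IncidenceAlgebra.one_apply]
  simp only [eIdem, ups_apply]
  by_cases hpq : p = q
  · subst hpq
    simp
  · rw [if_neg hpq]
    exact Finset.sum_eq_zero fun x _ => if_neg fun h => hpq (h.1.trans h.2.symm)

open Classical in
/-- The generator `f_{a⪯x}` of `ℤ[X]e_x`, or zero if `a ⪯ x` fails. -/
def genL (a x : X) : Lmod x :=
  if h : a ≤ x then ⟨ups a x h, ups a x h, ups_mul_ups a x x h le_rfl⟩ else 0

lemma coe_genL {a x : X} (h : a ≤ x) :
    (genL a x : IncidenceAlgebra ℤ X) = ups a x h := by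
  rw [genL, dif_pos h]

/-- Right multiplication by `f_{x⪯y}`, as a map `ℤ[X]e_x → ℤ[X]e_y`. -/
def rightMulUps {x y : X} (h : x ≤ y) : Lmod x →ₗ[ℤ] Lmod y :=
  LinearMap.restrict (AddMonoidHom.mulRight (ups x y h)).toIntLinearMap
    (fun a _ => mul_ups_mem_Lmod a h)

/-- Left multiplication by `f_{x⪯y}`, as a map `e_yℤ[X] → e_xℤ[X]`. -/
def leftMulUps {x y : X} (h : x ≤ y) : Rmod y →ₗ[ℤ] Rmod x :=
  LinearMap.restrict (AddMonoidHom.mulLeft (ups x y h)).toIntLinearMap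
    (fun b _ => ups_mul_mem_Rmod b h)

lemma rightMulUps_genL {a x y : X} (ha : a ≤ x) (h : x ≤ y) :
    rightMulUps h (genL a x) = genL a y := by
  apply Subtype.ext
  rw [coe_genL (ha.trans h)]
  change (genL a x : IncidenceAlgebra ℤ X) * ups x y h = _
  rw [coe_genL ha, ups_mul_ups]

lemma leftMulUps_self {x : X} (b : Rmod x) : leftMulUps le_rfl b = b :=
  Subtype.ext (eIdem_mul_Rmod b.2)

lemma leftMulUps_leftMulUps {x y z : X} (h1 : x ≤ y) (h2 : y ≤ z) (b : Rmod z) :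
    leftMulUps h1 (leftMulUps h2 b) = leftMulUps (h1.trans h2) b := by
  apply Subtype.ext
  change ups x y h1 * (ups y z h2 * b) = ups x z _ * b
  rw [← mul_assoc, ups_mul_ups]

open Classical in
/-- `leftMulUps` extended by zero to incomparable elements. -/
def leftMulUpsOrZero (x y : X) : Rmod y →ₗ[ℤ] Rmod x :=
  if h : x ≤ y then leftMulUps h else 0

/-- Evaluation of an element of `ℤ[X]e_x` at the pair `(a, x)`. -/
def coeffL (x a : X) : Lmod x →ₗ[ℤ] ℤ where
  toFun α := (α : IncidenceAlgebra ℤ X) a x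
  map_add' _ _ := rfl
  map_smul' _ _ := rfl

lemma coeffL_genL {a x : X} (h : a ≤ x) (c : X) :
    coeffL x c (genL a x) = if c = a then 1 else 0 := by
  change (genL a x : IncidenceAlgebra ℤ X) c x = _
  rw [coe_genL h, ups_apply]
  simp

/-- The map `ℤ[X]e_x → ℤ[X]e_u` sending `f_{a⪯x}` to `f_{a⪯u}` if `a ⪯ u`, and to zero
otherwise. -/
def truncL [Fintype X] (x u : X) : Lmod x →ₗ[ℤ] Lmod u :=
  ∑ a : X, (coeffL x a).smulRight (genL a u)

lemma truncL_apply [Fintype X] (x u : X) (α : Lmod x) :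
    truncL x u α = ∑ a : X, coeffL x a α • genL a u := by
  simp [truncL]

lemma truncL_genL [Fintype X] {a x : X} (h : a ≤ x) (u : X) :
    truncL x u (genL a x) = genL a u := by
  rw [truncL_apply, Finset.sum_eq_single a]
  · rw [coeffL_genL h, if_pos rfl, one_smul]
  · intro c _ hc
    rw [coeffL_genL h, if_neg hc, zero_smul]
  · intro h
    exact absurd (Finset.mem_univ _) h

lemma truncL_self [Fintype X] (x : X) (α : Lmod x) : truncL x x α = α := by
  have hsum (s : Finset X) (p q : X) :
      ((∑ a ∈ s, coeffL x a α • genL a x : Lmod x) : IncidenceAlgebra ℤ X) p q =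
        ∑ a ∈ s, coeffL x a α * (genL a x : IncidenceAlgebra ℤ X) p q := by
    induction s using Finset.induction_on with
    | empty => simp
    | insert a s ha ih => rw [Finset.sum_insert ha, Finset.sum_insert ha, ← ih]; rfl
  apply Subtype.ext
  ext p q _
  rw [truncL_apply, hsum, Lmod_apply α.2 p q, Finset.sum_eq_single p]
  · rw [Lmod_apply (genL p x).2 p q]
    by_cases hq : q = x
    · rw [if_pos hq, if_pos hq]
      by_cases hp : p ≤ x
      · rw [coe_genL hp, ups_apply]
        simp [coeffL]
      · rw [IncidenceAlgebra.apply_eq_zero_of_not_le hp,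
          IncidenceAlgebra.apply_eq_zero_of_not_le hp, mul_zero]
    · simp [hq]
  · intro c _ hc
    by_cases h : c ≤ x
    · rw [coe_genL h, ups_apply, if_neg (fun h => hc h.1.symm), mul_zero]
    · simp [genL, h]
  · intro h
    exact absurd (Finset.mem_univ _) h

lemma Lmod_hom_ext [Finite X] {M : Type*} [AddCommGroup M] [Module ℤ M] {x : X}
    {f g : Lmod x →ₗ[ℤ] M} (h : ∀ a, a ≤ x → f (genL a x) = g (genL a x)) : f = g := by
  have := Fintype.ofFinite X
  ext1 α
  rw [← truncL_self x α, truncL_apply, map_sum, map_sum]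
  refine Finset.sum_congr rfl fun a _ => ?_
  rw [f.map_smul, g.map_smul]
  by_cases ha : a ≤ x
  · rw [h a ha]
  · simp [genL, ha]

/-- The multiplication map `⊕_x ℤ[X]e_x ⊗ e_xℤ[X] → ℤ[X]`. -/
def mulMap [Fintype X] : (∀ x : X, Lmod x ⊗[ℤ] Rmod x) →ₗ[ℤ] IncidenceAlgebra ℤ X :=
  LinearMap.lsum ℤ _ ℤ fun x => TensorProduct.lift <|
    LinearMap.mk₂ ℤ (fun (a : Lmod x) (b : Rmod x) => (a : IncidenceAlgebra ℤ X) * b)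
      (fun _ _ _ => add_mul _ _ _) (fun _ _ _ => smul_mul_assoc _ _ _)
      (fun _ _ _ => mul_add _ _ _) (fun _ _ _ => mul_smul_comm _ _ _)

lemma mulMap_single [Fintype X] (x : X) (a : Lmod x) (b : Rmod x) :
    mulMap (Pi.single x (a ⊗ₜ[ℤ] b)) = (a : IncidenceAlgebra ℤ X) * b := by
  rw [mulMap, LinearMap.lsum_piSingle, TensorProduct.lift.tmul]
  rfl

/-- The differential `⊕_{y→x} ℤ[X]e_x ⊗ e_yℤ[X] → ⊕_x ℤ[X]e_x ⊗ e_xℤ[X]`. -/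
def covMap [Fintype (Cov X)] : (∀ p : Cov X, Lmod p.1.1 ⊗[ℤ] Rmod p.1.2) →ₗ[ℤ]
    (∀ x : X, Lmod x ⊗[ℤ] Rmod x) :=
  LinearMap.lsum ℤ _ ℤ fun p =>
    LinearMap.single ℤ (fun x : X => Lmod x ⊗[ℤ] Rmod x) p.1.1 ∘ₗ
        TensorProduct.map LinearMap.id (leftMulUps p.2.le) -
      LinearMap.single ℤ (fun x : X => Lmod x ⊗[ℤ] Rmod x) p.1.2 ∘ₗ
        TensorProduct.map (rightMulUps p.2.le) LinearMap.id

lemma covMap_single [Fintype (Cov X)] (p : Cov X) (a : Lmod p.1.1) (b : Rmod p.1.2) :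
    covMap (Pi.single p (a ⊗ₜ[ℤ] b)) =
      Pi.single p.1.1 (a ⊗ₜ[ℤ] leftMulUps p.2.le b) -
        Pi.single p.1.2 (rightMulUps p.2.le a ⊗ₜ[ℤ] b) := by
  rw [covMap, LinearMap.lsum_piSingle]
  rfl

/-- The degree zero part of the contracting homotopy, sending `α` to `∑ a, e_a ⊗ e_a α`. -/
def splitZero [Fintype X] : IncidenceAlgebra ℤ X →ₗ[ℤ] (∀ x : X, Lmod x ⊗[ℤ] Rmod x) :=
  LinearMap.pi fun a => (TensorProduct.mk ℤ (Lmod a) (Rmod a) (genL a a)).comp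
    ((AddMonoidHom.mulLeft (eIdem a)).toIntLinearMap.codRestrict (Rmod a)
      fun b => ups_mul_mem_Rmod b le_rfl)

lemma mulMap_splitZero [Fintype X] (α : IncidenceAlgebra ℤ X) : mulMap (splitZero α) = α := by
  rw [← Finset.univ_sum_single (splitZero α), map_sum]
  calc _ = ∑ a : X, eIdem a * α := by
        refine Finset.sum_congr rfl fun a _ => (mulMap_single _ _ _).trans ?_
        rw [coe_genL le_rfl]
        change ups a a _ * (ups a a _ * α) = ups a a _ * α
        rw [← mul_assoc, ups_mul_ups]
    _ = α := by rw [← Finset.sum_mul, sum_eIdem, one_mul]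

lemma splitZero_ups_mul [Fintype X] {a x : X} (h : a ≤ x) (b : Rmod x) :
    splitZero (ups a x h * (b : IncidenceAlgebra ℤ X)) = Pi.single a (genL a a ⊗ₜ[ℤ] leftMulUps h b) := by
  funext c
  have hc : splitZero (ups a x h * (b : IncidenceAlgebra ℤ X)) c = genL c c ⊗ₜ[ℤ]
      (⟨eIdem c * (ups a x h * b), ups_mul_mem_Rmod _ le_rfl⟩ : Rmod c) := rfl
  rw [hc]
  by_cases hca : c = a
  · subst hca
    rw [Pi.single_eq_same]
    congr 1
    exact Subtype.ext (eIdem_mul_Rmod (leftMulUps h b).2)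
  · rw [Pi.single_eq_of_ne hca]
    have : (⟨eIdem c * (ups a x h * b), ups_mul_mem_Rmod _ le_rfl⟩ : Rmod c) = 0 := by
      apply Subtype.ext
      change eIdem c * (ups a x h * b) = 0
      rw [← mul_assoc, eIdem_mul_ups_of_ne h hca, zero_mul]
    rw [this, tmul_zero]

/-- The degree one part of the contracting homotopy, sending `f_{a⪯x} ⊗ b` to minus the sum of
`f_{a⪯u} ⊗ f_{v⪯x}·b` over the covering relations `v → u` with `a ⪯ u` and `v ⪯ x`. -/
def splitOne [Fintype X] : (∀ x : X, Lmod x ⊗[ℤ] Rmod x) →ₗ[ℤ]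
    (∀ p : Cov X, Lmod p.1.1 ⊗[ℤ] Rmod p.1.2) :=
  LinearMap.lsum ℤ _ ℤ fun x => LinearMap.pi fun p =>
    -TensorProduct.map (truncL x p.1.1) (leftMulUpsOrZero p.1.2 x)

lemma splitOne_single [Fintype X] {a x : X} (h : a ≤ x) (b : Rmod x) (p : Cov X) :
    splitOne (Pi.single x (genL a x ⊗ₜ[ℤ] b)) p =
      -(genL a p.1.1 ⊗ₜ[ℤ] leftMulUpsOrZero p.1.2 x b) := by
  rw [splitOne, LinearMap.lsum_piSingle]
  change -(truncL x p.1.1 (genL a x) ⊗ₜ[ℤ] leftMulUpsOrZero p.1.2 x b) = _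
  rw [truncL_genL h]

lemma IsUniquePathSpace.eq_of_covBy {X : Type} [PartialOrder X] (hX : IsUniquePathSpace X)
    {a x x' y : X} (hx : a ≤ x) (hx' : a ≤ x') (hxy : x ⋖ y) (hxy' : x' ⋖ y) : x = x' := by
  obtain ⟨l, ⟨hl, hla⟩, -⟩ := hX a x hx
  obtain ⟨l', ⟨hl', hla'⟩, -⟩ := hX a x' hx'
  have := (hX a y (hx.trans hxy.le)).unique (y₁ := x :: l) (y₂ := x' :: l')
    ⟨List.isChain_cons_cons.2 ⟨hxy, hl⟩, by rwa [List.getLast_cons]⟩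
    ⟨List.isChain_cons_cons.2 ⟨hxy', hl'⟩, by rwa [List.getLast_cons]⟩
  exact (List.cons.inj this).1

lemma IsUniquePathSpace.le_of_lt_covBy (hX : IsUniquePathSpace X) {a x v y : X}
    (hx : a ≤ x) (hv : a ≤ v) (hxy : x ⋖ y) (hvy : v < y) : v ≤ x := by
  obtain ⟨w, hvw, hwy⟩ := exists_le_covBy_of_lt hvy
  rwa [hX.eq_of_covBy hx (hv.trans hvw) hxy hwy]

lemma splitOne_single_self [Fintype X] (a : X) (b : Rmod a) :
    splitOne (Pi.single a (genL a a ⊗ₜ[ℤ] b)) = 0 := by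
  funext p
  rw [splitOne_single le_rfl]
  by_cases hp : a ≤ p.1.1
  · rw [leftMulUpsOrZero, dif_neg (fun h => (hp.trans_lt p.2.lt).not_ge h)]
    simp
  · simp [genL, hp]

lemma splitOne_single_of_covBy [Fintype X] (hX : IsUniquePathSpace X) {a : X} (q : Cov X)
    (h : a ≤ q.1.1) (b : Rmod q.1.2) :
    splitOne (Pi.single q.1.2 (genL a q.1.2 ⊗ₜ[ℤ] b)) =
      splitOne (Pi.single q.1.1 (genL a q.1.1 ⊗ₜ[ℤ] leftMulUps q.2.le b)) -
        Pi.single q (genL a q.1.1 ⊗ₜ[ℤ] b) := by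
  funext p
  rw [Pi.sub_apply, splitOne_single h, splitOne_single (h.trans q.2.le)]
  by_cases hpq : p = q
  · subst hpq
    rw [Pi.single_eq_same, leftMulUpsOrZero, leftMulUpsOrZero, dif_pos le_rfl,
      dif_neg p.2.lt.not_ge, leftMulUps_self]
    simp
  rw [Pi.single_eq_of_ne hpq, sub_zero]
  by_cases hap : a ≤ p.1.1
  · congr 2
    by_cases hp : p.1.2 ≤ q.1.1
    · rw [leftMulUpsOrZero, leftMulUpsOrZero, dif_pos hp, dif_pos (hp.trans q.2.le),
        leftMulUps_leftMulUps]
    · have hp' : ¬ p.1.2 ≤ q.1.2 := by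
        intro hle
        rcases hle.eq_or_lt with heq | hlt
        · have h1 := hX.eq_of_covBy hap h p.2 (heq ▸ q.2)
          exact hpq (Subtype.ext (Prod.ext h1 heq))
        · exact hp (hX.le_of_lt_covBy h (hap.trans p.2.le) q.2 hlt)
      rw [leftMulUpsOrZero, leftMulUpsOrZero, dif_neg hp, dif_neg hp']
      rfl
  · simp [genL, hap]

lemma splitOne_comp_covMap [Fintype X] [Fintype (Cov X)] (hX : IsUniquePathSpace X) :
    splitOne ∘ₗ covMap (X := X) = LinearMap.id := by
  refine LinearMap.pi_ext' fun q => TensorProduct.ext <| Lmod_hom_ext fun a ha => ?_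
  ext1 b
  change splitOne (covMap (Pi.single q (genL a q.1.1 ⊗ₜ[ℤ] b))) =
    Pi.single q (genL a q.1.1 ⊗ₜ[ℤ] b)
  rw [covMap_single, map_sub, rightMulUps_genL ha, splitOne_single_of_covBy hX q ha, sub_sub_cancel]

lemma covMap_splitOne_single [Fintype X] [Fintype (Cov X)] (hX : IsUniquePathSpace X)
    {a x : X} (h : a ≤ x) (b : Rmod x) :
    covMap (splitOne (Pi.single x (genL a x ⊗ₜ[ℤ] b))) =
      Pi.single x (genL a x ⊗ₜ[ℤ] b) - Pi.single a (genL a a ⊗ₜ[ℤ] leftMulUps h b) := by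
  induction x using WellFoundedLT.induction with
  | ind y ih =>
    rcases h.eq_or_lt with rfl | hlt
    · rw [splitOne_single_self, map_zero, leftMulUps_self, sub_self]
    · obtain ⟨x, hax, hxy⟩ := exists_le_covBy_of_lt hlt
      have hs := splitOne_single_of_covBy hX ⟨(x, y), hxy⟩ hax b
      have hc := covMap_single ⟨(x, y), hxy⟩ (genL a x) b
      dsimp only at hs hc
      rw [hs, map_sub, hc, ih x hxy.lt hax, leftMulUps_leftMulUps, rightMulUps_genL hax]
      abel

lemma splitZero_comp_mulMap_add_covMap_comp_splitOne [Fintype X] [Fintype (Cov X)]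
    (hX : IsUniquePathSpace X) :
    splitZero ∘ₗ mulMap + covMap ∘ₗ splitOne (X := X) = LinearMap.id := by
  refine LinearMap.pi_ext' fun x => TensorProduct.ext <| Lmod_hom_ext fun a ha => ?_
  ext1 b
  change splitZero (mulMap (Pi.single x (genL a x ⊗ₜ[ℤ] b))) +
    covMap (splitOne (Pi.single x (genL a x ⊗ₜ[ℤ] b))) = Pi.single x (genL a x ⊗ₜ[ℤ] b)
  rw [covMap_splitOne_single hX ha, mulMap_single, coe_genL ha, splitZero_ups_mul,
    add_sub_cancel]

lemma mulMap_comp_covMap [Fintype X] [Fintype (Cov X)] :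
    mulMap ∘ₗ covMap (X := X) = 0 := by
  refine LinearMap.pi_ext' fun q => TensorProduct.ext' fun a b => ?_
  change mulMap (covMap (Pi.single q (a ⊗ₜ[ℤ] b))) = 0
  rw [covMap_single, map_sub, mulMap_single, mulMap_single, sub_eq_zero]
  exact (mul_assoc _ _ _).symm

lemma bimodLPi_single (c : IncidenceAlgebra ℤ X) (x : X) (a : Lmod x) (b : Rmod x) :
    bimodLPi c (Pi.single x (a ⊗ₜ[ℤ] b)) = Pi.single x (lactL c x a ⊗ₜ[ℤ] b) :=
  funext <| Pi.apply_single (fun x => TensorProduct.map (lactL c x) (LinearMap.id (M := Rmod x)))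
    (fun _ => map_zero _) x (a ⊗ₜ[ℤ] b)

lemma bimodRPi_single (c : IncidenceAlgebra ℤ X) (x : X) (a : Lmod x) (b : Rmod x) :
    bimodRPi c (Pi.single x (a ⊗ₜ[ℤ] b)) = Pi.single x (a ⊗ₜ[ℤ] ractR c x b) :=
  funext <| Pi.apply_single (fun x => TensorProduct.map (LinearMap.id (M := Lmod x)) (ractR c x))
    (fun _ => map_zero _) x (a ⊗ₜ[ℤ] b)

lemma bimodLCov_single (c : IncidenceAlgebra ℤ X) (p : Cov X) (a : Lmod p.1.1)
    (b : Rmod p.1.2) :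
    bimodLCov c (Pi.single p (a ⊗ₜ[ℤ] b)) = Pi.single p (lactL c p.1.1 a ⊗ₜ[ℤ] b) :=
  funext <| Pi.apply_single
    (fun p : Cov X => TensorProduct.map (lactL c p.1.1) (LinearMap.id (M := Rmod p.1.2)))
    (fun _ => map_zero _) p (a ⊗ₜ[ℤ] b)

lemma bimodRCov_single (c : IncidenceAlgebra ℤ X) (p : Cov X) (a : Lmod p.1.1)
    (b : Rmod p.1.2) :
    bimodRCov c (Pi.single p (a ⊗ₜ[ℤ] b)) = Pi.single p (a ⊗ₜ[ℤ] ractR c p.1.2 b) :=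
  funext <| Pi.apply_single
    (fun p : Cov X => TensorProduct.map (LinearMap.id (M := Lmod p.1.1)) (ractR c p.1.2))
    (fun _ => map_zero _) p (a ⊗ₜ[ℤ] b)

lemma covMap_comp_bimodLCov [Fintype (Cov X)] (c : IncidenceAlgebra ℤ X) :
    covMap ∘ₗ bimodLCov c = bimodLPi c ∘ₗ covMap := by
  refine LinearMap.pi_ext' fun q => TensorProduct.ext' fun a b => ?_
  change covMap (bimodLCov c (Pi.single q (a ⊗ₜ[ℤ] b))) =
    bimodLPi c (covMap (Pi.single q (a ⊗ₜ[ℤ] b)))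
  rw [bimodLCov_single, covMap_single, covMap_single, map_sub, bimodLPi_single, bimodLPi_single]
  congr 3
  exact Subtype.ext (mul_assoc _ _ _)

lemma covMap_comp_bimodRCov [Fintype (Cov X)] (c : IncidenceAlgebra ℤ X) :
    covMap ∘ₗ bimodRCov c = bimodRPi c ∘ₗ covMap := by
  refine LinearMap.pi_ext' fun q => TensorProduct.ext' fun a b => ?_
  change covMap (bimodRCov c (Pi.single q (a ⊗ₜ[ℤ] b))) =
    bimodRPi c (covMap (Pi.single q (a ⊗ₜ[ℤ] b)))
  rw [bimodRCov_single, covMap_single, covMap_single, map_sub, bimodRPi_single, bimodRPi_single]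
  congr 3
  exact Subtype.ext (mul_assoc _ _ _).symm

lemma mulMap_comp_bimodLPi [Fintype X] (c : IncidenceAlgebra ℤ X) :
    mulMap ∘ₗ bimodLPi c = (AddMonoidHom.mulLeft c).toIntLinearMap ∘ₗ mulMap := by
  refine LinearMap.pi_ext' fun x => TensorProduct.ext' fun a b => ?_
  change mulMap (bimodLPi c (Pi.single x (a ⊗ₜ[ℤ] b))) = c * mulMap (Pi.single x (a ⊗ₜ[ℤ] b))
  rw [bimodLPi_single, mulMap_single, mulMap_single]
  exact mul_assoc _ _ _

lemma mulMap_comp_bimodRPi [Fintype X] (c : IncidenceAlgebra ℤ X) :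
    mulMap ∘ₗ bimodRPi c = (AddMonoidHom.mulRight c).toIntLinearMap ∘ₗ mulMap := by
  refine LinearMap.pi_ext' fun x => TensorProduct.ext' fun a b => ?_
  change mulMap (bimodRPi c (Pi.single x (a ⊗ₜ[ℤ] b))) = mulMap (Pi.single x (a ⊗ₜ[ℤ] b)) * c
  rw [bimodRPi_single, mulMap_single, mulMap_single]
  exact (mul_assoc _ _ _).symm

end Resolution

theorem incidence_algebra_bimodule_resolution
    (X : Type) [PartialOrder X] [Fintype X] [LocallyFiniteOrder X] [DecidableEq X]
    (hX : IsUniquePathSpace X) :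
    ∃ (d : (∀ p : Cov X, Lmod p.1.1 ⊗[ℤ] Rmod p.1.2) →ₗ[ℤ]
          (∀ x : X, Lmod x ⊗[ℤ] Rmod x))
      (m : (∀ x : X, Lmod x ⊗[ℤ] Rmod x) →ₗ[ℤ] IncidenceAlgebra ℤ X),
      -- the second map is determined on each summand by `a ⊗ b ↦ a·b`:
      (∀ (x : X) (a : Lmod x) (b : Rmod x),
        m (Pi.single x (a ⊗ₜ[ℤ] b)) = (a : IncidenceAlgebra ℤ X) * b) ∧
      -- the first map is determined on the summand indexed by the covering relation
      -- `y → x` (with `x ⋖ y`) by `a ⊗ b ↦ (a ⊗ f_{x⪯y}·b, −a·f_{x⪯y} ⊗ b)`: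
      (∀ (p : Cov X) (a : Lmod p.1.1) (b : Rmod p.1.2),
        d (Pi.single p (a ⊗ₜ[ℤ] b)) =
          Pi.single p.1.1
            (a ⊗ₜ[ℤ]
              (⟨ups p.1.1 p.1.2 p.2.le * b, ups_mul_mem_Rmod _ p.2.le⟩ : Rmod p.1.1)) -
          Pi.single p.1.2
            ((⟨(a : IncidenceAlgebra ℤ X) * ups p.1.1 p.1.2 p.2.le,
                mul_ups_mem_Lmod _ p.2.le⟩ : Lmod p.1.2) ⊗ₜ[ℤ] b)) ∧
      -- `d` and `m` are maps of `ℤ[X]`-bimodules: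
      (∀ (c : IncidenceAlgebra ℤ X) (t : ∀ p : Cov X, Lmod p.1.1 ⊗[ℤ] Rmod p.1.2),
        d (bimodLCov c t) = bimodLPi c (d t)) ∧
      (∀ (c : IncidenceAlgebra ℤ X) (t : ∀ p : Cov X, Lmod p.1.1 ⊗[ℤ] Rmod p.1.2),
        d (bimodRCov c t) = bimodRPi c (d t)) ∧
      (∀ (c : IncidenceAlgebra ℤ X) (t : ∀ x : X, Lmod x ⊗[ℤ] Rmod x),
        m (bimodLPi c t) = c * m t) ∧
      (∀ (c : IncidenceAlgebra ℤ X) (t : ∀ x : X, Lmod x ⊗[ℤ] Rmod x),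
        m (bimodRPi c t) = m t * c) ∧
      -- exactness of `0 → ⊕_{y→x} ℤ[X]e_x ⊗ e_yℤ[X] → ⊕_x ℤ[X]e_x ⊗ e_xℤ[X] → ℤ[X] → 0`:
      Function.Injective d ∧ Function.Exact d m ∧ Function.Surjective m := by
  have := Fintype.ofFinite (Cov X)
  have hid := splitZero_comp_mulMap_add_covMap_comp_splitOne hX
  refine ⟨covMap, mulMap, mulMap_single, covMap_single,
    fun c => LinearMap.congr_fun (covMap_comp_bimodLCov c),
    fun c => LinearMap.congr_fun (covMap_comp_bimodRCov c),
    fun c => LinearMap.congr_fun (mulMap_comp_bimodLPi c),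
    fun c => LinearMap.congr_fun (mulMap_comp_bimodRPi c),
    Function.LeftInverse.injective (LinearMap.congr_fun (splitOne_comp_covMap hX)),
    fun t => ⟨fun ht => ⟨splitOne t, ?_⟩, ?_⟩,
    Function.RightInverse.surjective mulMap_splitZero⟩
  · have := LinearMap.congr_fun hid t
    rwa [LinearMap.add_apply, LinearMap.comp_apply, ht, map_zero, zero_add] at this
  · rintro ⟨s, rfl⟩
    exact LinearMap.congr_fun mulMap_comp_covMap s

end
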